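/- Let 𝒜 be an abelian category and 𝒞 a full additive subcategory such that 𝒞⊥𝒞 holds and 𝒞 is closed under direct summands. Then for every object A lying in 𝒢(𝒞)^⊥, one has 𝒢(𝒞)-dim A = 𝒞-dim A. -/

import Mathlib

open CategoryTheory CategoryTheory.Limits CategoryTheory.Abelian ZeroObject

universe w v u

namespace RelHomDim

variable {𝒜 : Type u} [Category.{v} 𝒜] [Abelian 𝒜]

/-- A class of objects of an abelian category corresponding to a full additive
subcategory: it is closed under isomorphisms, contains a zero object and is
closed under finite direct sums (biproducts). -/
def IsAdditiveClass (P : 𝒜 → Prop) : Prop :=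
  P 0 ∧ (∀ ⦃X Y : 𝒜⦄, (X ≅ Y) → P X → P Y) ∧ ∀ ⦃X Y : 𝒜⦄, P X → P Y → P (X ⊞ Y)

/-- A class of objects is closed under direct summands. -/
def ClosedUnderSummands (P : 𝒜 → Prop) : Prop :=
  ∀ X Y : 𝒜, P (X ⊞ Y) → P X ∧ P Y

/-- `Hom(W,-)`-exactness of a short exact sequence `0 → X₁ → X₂ → X₃ → 0`:
the induced sequence `0 → Hom(W,X₁) → Hom(W,X₂) → Hom(W,X₃) → 0` is exact. -/
def CovHomExact (W : 𝒜) (S : ShortComplex 𝒜) : Prop :=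
  (∀ a b : W ⟶ S.X₁, a ≫ S.f = b ≫ S.f → a = b) ∧
  (∀ b : W ⟶ S.X₂, b ≫ S.g = 0 → ∃ a : W ⟶ S.X₁, a ≫ S.f = b) ∧
  (∀ c : W ⟶ S.X₃, ∃ b : W ⟶ S.X₂, b ≫ S.g = c)

/-- A short exact sequence is `ℰ`-proper (i.e. `Hom(ℰ,-)`-exact) if it is
`Hom(E,-)`-exact for every object `E` in the class `ℰ`. -/
def EProper (E : 𝒜 → Prop) (S : ShortComplex 𝒜) : Prop :=
  ∀ W, E W → CovHomExact W S

/-- `ResW P W n K A` holds iff there is an exact sequence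
`0 → K → X_{n-1} → ⋯ → X_0 → A → 0` in `𝒜` with all the `n` middle terms `X i`
in `P`, such that each of the short exact sequences obtained by splicing
satisfies `W` (this encodes, e.g., `Hom(ℰ,-)`-exactness of the whole sequence). -/
def ResW (P : 𝒜 → Prop) (W : ShortComplex 𝒜 → Prop) : ℕ → 𝒜 → 𝒜 → Prop
  | 0 => fun K A => Nonempty (K ≅ A)
  | n + 1 => fun K A => ∃ (B X : 𝒜) (f : B ⟶ X) (g : X ⟶ A) (w : f ≫ g = 0),
      P X ∧ (ShortComplex.mk f g w).ShortExact ∧ W (ShortComplex.mk f g w) ∧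
      ResW P W n K B

/-- `Res P n K A` : there is an exact sequence `0 → K → X_{n-1} → ⋯ → X_0 → A → 0`
with all middle terms in `P`. -/
abbrev Res (P : 𝒜 → Prop) : ℕ → 𝒜 → 𝒜 → Prop := ResW P fun _ => True

/-- `CoresW P W n A K` holds iff there is an exact sequence
`0 → A → X^0 → ⋯ → X^{n-1} → K → 0` with all middle terms in `P` and each
spliced short exact piece satisfying `W`. -/
def CoresW (P : 𝒜 → Prop) (W : ShortComplex 𝒜 → Prop) : ℕ → 𝒜 → 𝒜 → Prop
  | 0 => fun A K => Nonempty (A ≅ K)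
  | n + 1 => fun A K => ∃ (X B : 𝒜) (f : A ⟶ X) (g : X ⟶ B) (w : f ≫ g = 0),
      P X ∧ (ShortComplex.mk f g w).ShortExact ∧ W (ShortComplex.mk f g w) ∧
      CoresW P W n B K

/-- `Cores P n A K` : there is an exact sequence `0 → A → X^0 → ⋯ → X^{n-1} → K → 0`
with all middle terms in `P`. -/
abbrev Cores (P : 𝒜 → Prop) : ℕ → 𝒜 → 𝒜 → Prop := CoresW P fun _ => True

/-- The `P`-dimension of `A` : the infimum of the `n ≥ 0` such that there is
an exact sequence `0 → C_n → ⋯ → C_1 → C_0 → A → 0` with all `C_i` in `P`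
(`⊤ = ∞` if there is no such `n`). -/
noncomputable def rdim (P : 𝒜 → Prop) (A : 𝒜) : ℕ∞ :=
  sInf {c : ℕ∞ | ∃ n : ℕ, c = n ∧ ∃ K, P K ∧ Res P n K A}

/-- The `P`-codimension of `A` : the infimum of the `n ≥ 0` such that there is
an exact sequence `0 → A → C^0 → C^1 → ⋯ → C^n → 0` with all `C^i` in `P`
(`⊤ = ∞` if there is no such `n`). -/
noncomputable def rcodim (P : 𝒜 → Prop) (A : 𝒜) : ℕ∞ :=
  sInf {c : ℕ∞ | ∃ n : ℕ, c = n ∧ ∃ K, P K ∧ Cores P n A K}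

/-- `A` belongs to `P^⊥`, i.e. `Ext^i(C, A) = 0` for all `C` in `P` and `i ≥ 1`. -/
def MemRightPerp [HasExt.{w} 𝒜] (P : 𝒜 → Prop) (A : 𝒜) : Prop :=
  ∀ C, P C → ∀ i : ℕ, 1 ≤ i → Subsingleton (Abelian.Ext C A i)

/-- `A` belongs to `^⊥P`, i.e. `Ext^i(A, C) = 0` for all `C` in `P` and `i ≥ 1`. -/
def MemLeftPerp [HasExt.{w} 𝒜] (P : 𝒜 → Prop) (A : 𝒜) : Prop :=
  ∀ C, P C → ∀ i : ℕ, 1 ≤ i → Subsingleton (Abelian.Ext A C i)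

/-- `𝒞` is an `ℰ`-proper generator for `𝒯` (`𝒞 ⊆ 𝒯` and every object of `𝒯`
is an `ℰ`-proper quotient of an object of `𝒞` with kernel in `𝒯`). -/
def IsProperGenerator (E C T : 𝒜 → Prop) : Prop :=
  (∀ ⦃X⦄, C X → T X) ∧
  ∀ X, T X → ∃ (X' Cb : 𝒜) (f : X' ⟶ Cb) (g : Cb ⟶ X) (w : f ≫ g = 0),
    C Cb ∧ T X' ∧ (ShortComplex.mk f g w).ShortExact ∧ EProper E (ShortComplex.mk f g w)

/-- `𝒞` is a cogenerator for `𝒯`. -/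
def IsCogenerator (C T : 𝒜 → Prop) : Prop :=
  (∀ ⦃X⦄, C X → T X) ∧
  ∀ X, T X → ∃ (Cb X' : 𝒜) (f : X ⟶ Cb) (g : Cb ⟶ X') (w : f ≫ g = 0),
    C Cb ∧ T X' ∧ (ShortComplex.mk f g w).ShortExact

/-- `𝒯` is closed under `ℰ`-proper extensions. -/
def ClosedUnderProperExtensions (E T : 𝒜 → Prop) : Prop :=
  ∀ S : ShortComplex 𝒜, S.ShortExact → EProper E S → T S.X₁ → T S.X₃ → T S.X₂

/-- `𝒯` is closed under kernels of `ℰ`-proper epimorphisms. -/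
def ClosedUnderProperKernels (E T : 𝒜 → Prop) : Prop :=
  ∀ S : ShortComplex 𝒜, S.ShortExact → EProper E S → T S.X₂ → T S.X₃ → T S.X₁

/-- `𝒯` is an `ℰ`-preresolving subcategory with `ℰ`-proper generator `𝒞`. -/
def IsPreresolving (E T C : 𝒜 → Prop) : Prop :=
  IsProperGenerator E C T ∧ ClosedUnderProperExtensions E T


/-- Exactness of a four-term sequence `0 → M → T₁ → T₀ → A → 0`. -/
def FourTermExact {M T1 T0 A : 𝒜} (f : M ⟶ T1) (g : T1 ⟶ T0) (h : T0 ⟶ A) : Prop :=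
  Mono f ∧ Epi h ∧ ∃ (w₁ : f ≫ g = 0) (w₂ : g ≫ h = 0),
    (ShortComplex.mk f g w₁).Exact ∧ (ShortComplex.mk g h w₂).Exact

/-- `Hom(W,-)`-exactness of the four-term exact sequence `0 → M → T₁ → T₀ → A → 0` :
the induced sequence `0 → Hom(W,M) → Hom(W,T₁) → Hom(W,T₀) → Hom(W,A) → 0` is exact. -/
def CovHomExact4 (W : 𝒜) {M T1 T0 A : 𝒜} (f : M ⟶ T1) (g : T1 ⟶ T0) (h : T0 ⟶ A) : Prop :=
  (∀ a b : W ⟶ M, a ≫ f = b ≫ f → a = b) ∧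
  (∀ b : W ⟶ T1, b ≫ g = 0 → ∃ a : W ⟶ M, a ≫ f = b) ∧
  (∀ c : W ⟶ T0, c ≫ h = 0 → ∃ b : W ⟶ T1, b ≫ g = c) ∧
  (∀ d : W ⟶ A, ∃ c : W ⟶ T0, c ≫ h = d)

/-- There is an exact sequence `0 → M → K⁰ → C¹ → ⋯ → Cⁿ → 0` with `K⁰` in `T`
and all `C^i` in `C`. -/
def MixedCores (T C : 𝒜 → Prop) : ℕ → 𝒜 → Prop
  | 0 => fun M => ∃ K, T K ∧ Nonempty (M ≅ K)
  | n + 1 => fun M => ∃ (K H : 𝒜) (f : M ⟶ K) (g : K ⟶ H) (w : f ≫ g = 0),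
      T K ∧ (ShortComplex.mk f g w).ShortExact ∧ ∃ K', C K' ∧ Cores C n H K'

/-- The Gorenstein subcategory `𝒢(𝒞)` : objects `A` admitting a doubly infinite
exact sequence `⋯ → X_{-1} → X_0 → X_1 → ⋯` with all terms in `𝒞`, which is both
`Hom(𝒞,-)`-exact and `Hom(-,𝒞)`-exact, such that `A ≅ Im(X_0 → X_1)`. -/
def IsGorenstein (P : 𝒜 → Prop) (A : 𝒜) : Prop :=
  ∃ (X : ℤ → 𝒜) (d : ∀ i : ℤ, X i ⟶ X (i + 1)) (w : ∀ i, d i ≫ d (i + 1) = 0),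
    (∀ i, P (X i)) ∧
    (∀ i, (ShortComplex.mk (d i) (d (i + 1)) (w i)).Exact) ∧
    (∀ C, P C → ∀ (i : ℤ) (f : C ⟶ X (i + 1)), f ≫ d (i + 1) = 0 →
      ∃ g : C ⟶ X i, g ≫ d i = f) ∧
    (∀ C, P C → ∀ (i : ℤ) (f : X (i + 1) ⟶ C), d i ≫ f = 0 →
      ∃ g : X (i + 1 + 1) ⟶ C, d (i + 1) ≫ g = f) ∧
    Nonempty (A ≅ Limits.image (d 0))

end RelHomDim

namespace RelHomDim

section ShortExact

variable {𝒜 : Type u} [Category.{v} 𝒜] [Abelian 𝒜]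

lemma snakeInput_shortExact_L₀ (D : ShortComplex.SnakeInput 𝒜) [Mono D.L₁.f] [Epi D.v₁₂.τ₁] :
    D.L₀.ShortExact := by
  have hz : D.v₂₃.τ₁ = 0 := by
    rw [← cancel_epi D.v₁₂.τ₁, D.w₁₃_τ₁, comp_zero]
  have hZ : IsZero D.L₃.X₁ := by
    rw [IsZero.iff_id_eq_zero, ← cancel_epi D.v₂₃.τ₁, hz]
    simp
  exact .mk' D.L₀_exact inferInstance (D.L₁'_exact.epi_f (hZ.eq_of_tgt _ _))

lemma exists_shortExact_kernel {S T : ShortComplex 𝒜} (hS : S.ShortExact) (hT : T.ShortExact)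
    (φ : S ⟶ T) (h₁ : Epi φ.τ₁) (h₃ : Epi φ.τ₃) :
    ∃ (R : ShortComplex 𝒜) (ψ : R ⟶ S) (w₁ : ψ.τ₁ ≫ φ.τ₁ = 0) (w₂ : ψ.τ₂ ≫ φ.τ₂ = 0)
      (w₃ : ψ.τ₃ ≫ φ.τ₃ = 0), R.ShortExact ∧ (ShortComplex.mk _ _ w₁).ShortExact ∧
      (ShortComplex.mk _ _ w₂).ShortExact ∧ (ShortComplex.mk _ _ w₃).ShortExact := by
  have := hS.epi_g
  have := hT.epi_g
  have h₂ : Epi φ.τ₂ := ShortComplex.epi_τ₂_of_exact_of_epi φ hT.exact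
  let D : ShortComplex.SnakeInput 𝒜 :=
    { L₀ := kernel φ
      L₁ := S
      L₂ := T
      L₃ := cokernel φ
      v₀₁ := kernel.ι φ
      v₁₂ := φ
      v₂₃ := cokernel.π φ
      w₀₂ := kernel.condition φ
      w₁₃ := cokernel.condition φ
      h₀ := kernelIsKernel φ
      h₃ := cokernelIsCokernel φ
      L₁_exact := hS.exact
      epi_L₁_g := hS.epi_g
      L₂_exact := hT.exact
      mono_L₂_f := hT.mono_f }
  have : Mono D.L₁.f := hS.mono_f
  have : Epi D.v₁₂.τ₁ := h₁
  exact ⟨D.L₀, D.v₀₁, D.w₀₂_τ₁, D.w₀₂_τ₂, D.w₀₂_τ₃, snakeInput_shortExact_L₀ D,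
    .mk' D.exact_C₁_up D.mono_v₀₁_τ₁ h₁, .mk' D.exact_C₂_up D.mono_v₀₁_τ₂ h₂,
    .mk' D.exact_C₃_up D.mono_v₀₁_τ₃ h₃⟩

lemma exists_shortExact_cokernel {S T : ShortComplex 𝒜} (hS : S.ShortExact) (hT : T.ShortExact)
    (φ : S ⟶ T) (h₁ : Mono φ.τ₁) (h₃ : Mono φ.τ₃) :
    ∃ (R : ShortComplex 𝒜) (ψ : T ⟶ R) (w₁ : φ.τ₁ ≫ ψ.τ₁ = 0) (w₂ : φ.τ₂ ≫ ψ.τ₂ = 0)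
      (w₃ : φ.τ₃ ≫ ψ.τ₃ = 0), R.ShortExact ∧ (ShortComplex.mk _ _ w₁).ShortExact ∧
      (ShortComplex.mk _ _ w₂).ShortExact ∧ (ShortComplex.mk _ _ w₃).ShortExact := by
  obtain ⟨R, ψ, w₁, w₂, w₃, hR, h₁, h₂, h₃⟩ :=
    exists_shortExact_kernel hT.op hS.op (ShortComplex.opMap φ)
      (inferInstanceAs (Epi φ.τ₃.op)) (inferInstanceAs (Epi φ.τ₁.op))
  exact ⟨R.unop, ⟨ψ.τ₃.unop, ψ.τ₂.unop, ψ.τ₁.unop,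
      Quiver.Hom.op_inj ψ.comm₂₃.symm, Quiver.Hom.op_inj ψ.comm₁₂.symm⟩,
    Quiver.Hom.op_inj w₃, Quiver.Hom.op_inj w₂, Quiver.Hom.op_inj w₁,
    hR.unop, h₃.unop, h₂.unop, h₁.unop⟩

lemma nonempty_iso_of_shortExact_g {K K' X Y : 𝒜} {f : K ⟶ X} {f' : K' ⟶ X} {g : X ⟶ Y}
    {w : f ≫ g = 0} {w' : f' ≫ g = 0} (h : (ShortComplex.mk f g w).ShortExact)
    (h' : (ShortComplex.mk f' g w').ShortExact) : Nonempty (K ≅ K') :=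
  ⟨h.fIsKernel.conePointUniqueUpToIso h'.fIsKernel⟩

lemma nonempty_iso_of_shortExact_f {K X Y Y' : 𝒜} {f : K ⟶ X} {g : X ⟶ Y} {g' : X ⟶ Y'}
    {w : f ≫ g = 0} {w' : f ≫ g' = 0} (h : (ShortComplex.mk f g w).ShortExact)
    (h' : (ShortComplex.mk f g' w').ShortExact) : Nonempty (Y ≅ Y') :=
  ⟨h.gIsCokernel.coconePointUniqueUpToIso h'.gIsCokernel⟩

lemma shortExact_biprod (X Y : 𝒜) :
    (ShortComplex.mk (biprod.inl : X ⟶ X ⊞ Y) biprod.snd biprod.inl_snd).ShortExact :=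
  (ShortComplex.Splitting.ofHasBinaryBiproduct X Y).shortExact

/-- The short exact sequence `0 → H → P → A → 0` obtained from `0 → B → X → A → 0` by pushing
out along `B → H`. -/
lemma exists_shortExact_of_isPushout {B X A H P : 𝒜} {f : B ⟶ X} {g : X ⟶ A} {w : f ≫ g = 0}
    (h : (ShortComplex.mk f g w).ShortExact) {k : B ⟶ H} {i : X ⟶ P} {j : H ⟶ P}
    (sq : IsPushout f k i j) :
    ∃ (q : P ⟶ A) (w' : j ≫ q = 0), (ShortComplex.mk j q w').ShortExact := by
  have : Mono f := h.mono_f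
  have : Epi g := h.epi_g
  have : Mono j := Abelian.mono_inr_of_isColimit f k sq.isColimit
  have hq : f ≫ g = k ≫ (0 : H ⟶ A) := by simp [w]
  refine ⟨sq.desc g 0 hq, by simp, .mk' ?_ inferInstance ?_⟩
  · refine ShortComplex.exact_of_g_is_cokernel _ (CokernelCofork.IsColimit.ofπ _ _
      (fun m hm => h.gIsCokernel.desc (CokernelCofork.ofπ (i ≫ m) ?_)) (fun m hm => ?_) ?_)
    · dsimp
      rw [sq.w_assoc, hm, comp_zero]
    · have e : g ≫ h.gIsCokernel.desc (CokernelCofork.ofπ (f := f) (i ≫ m)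
          (by rw [sq.w_assoc, hm, comp_zero])) = i ≫ m :=
        h.gIsCokernel.fac _ WalkingParallelPair.one
      apply sq.hom_ext
      · simpa using e
      · simpa using hm.symm
    · intro T m hm b hb
      rw [← cancel_epi g]
      have e : g ≫ h.gIsCokernel.desc (CokernelCofork.ofπ (f := f) (i ≫ m)
          (by rw [sq.w_assoc, hm, comp_zero])) = i ≫ m :=
        h.gIsCokernel.fac _ WalkingParallelPair.one
      refine Eq.trans ?_ e.symm
      simp [← hb]
  · have : Epi (i ≫ sq.desc g 0 hq) := by simpa
    exact epi_of_epi i _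

/-- The short exact sequence `0 → K → X → P → 0` obtained from `0 → K → B → H → 0` and a
monomorphism `B → X` by pushing out along `B → H`. -/
lemma shortExact_of_isPushout {K B X H P : 𝒜} {f : B ⟶ X} {l : K ⟶ B} {k : B ⟶ H}
    {w : l ≫ k = 0} (h : (ShortComplex.mk l k w).ShortExact) [Mono f] {i : X ⟶ P} {j : H ⟶ P}
    (sq : IsPushout f k i j) :
    ∃ (w' : (l ≫ f) ≫ i = 0), (ShortComplex.mk (l ≫ f) i w').ShortExact := by
  have : Mono l := h.mono_f
  have : Epi k := h.epi_g
  have hw : (l ≫ f) ≫ i = 0 := by rw [Category.assoc, sq.w, ← Category.assoc, w, zero_comp]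
  have : Epi i := ⟨fun a b hab => sq.hom_ext hab (by
    rw [← cancel_epi k, ← sq.w_assoc, ← sq.w_assoc, hab])⟩
  refine ⟨hw, .mk' ?_ (by dsimp; infer_instance) (by dsimp; infer_instance)⟩
  have hd (T : 𝒜) (m : X ⟶ T) (hm : (l ≫ f) ≫ m = 0) : ∃ d : P ⟶ T, i ≫ d = m := by
    have hm' : l ≫ f ≫ m = 0 := by simpa using hm
    have e : k ≫ h.gIsCokernel.desc (CokernelCofork.ofπ (f := l) (f ≫ m) hm') = f ≫ m :=
      h.gIsCokernel.fac _ WalkingParallelPair.one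
    exact ⟨sq.desc m _ e.symm, by simp⟩
  choose d hd' using hd
  exact ShortComplex.exact_of_g_is_cokernel _ (CokernelCofork.IsColimit.ofπ _ _
    (fun m hm => d _ m hm) (fun m hm => hd' _ m hm)
    (fun m hm b hb => by rw [← cancel_epi i, hb, hd']))

lemma shortExact_image {X Y Z : 𝒜} {d : X ⟶ Y} {d' : Y ⟶ Z} {w : d ≫ d' = 0}
    (h : (ShortComplex.mk d d' w).Exact) :
    ∃ w' : Limits.image.ι d ≫ factorThruImage d' = 0,
      (ShortComplex.mk (Limits.image.ι d) (factorThruImage d') w').ShortExact := by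
  have w₁ : d ≫ factorThruImage d' = 0 := by
    rw [← cancel_mono (Limits.image.ι d')]; simpa using w
  have w₂ : Limits.image.ι d ≫ factorThruImage d' = 0 := by
    rw [← cancel_epi (factorThruImage d)]; simpa using w₁
  refine ⟨w₂, .mk' ?_ inferInstance inferInstance⟩
  let φ : ShortComplex.mk d (factorThruImage d') w₁ ⟶ ShortComplex.mk d d' w :=
    { τ₁ := 𝟙 _, τ₂ := 𝟙 _, τ₃ := Limits.image.ι d' }
  let ψ : ShortComplex.mk d (factorThruImage d') w₁ ⟶
      ShortComplex.mk (Limits.image.ι d) (factorThruImage d') w₂ :=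
    { τ₁ := factorThruImage d, τ₂ := 𝟙 _, τ₃ := 𝟙 _ }
  have : Epi φ.τ₁ := by dsimp [φ]; infer_instance
  have : IsIso φ.τ₂ := by dsimp [φ]; infer_instance
  have : Mono φ.τ₃ := by dsimp [φ]; infer_instance
  have : Epi ψ.τ₁ := by dsimp [ψ]; infer_instance
  have : IsIso ψ.τ₂ := by dsimp [ψ]; infer_instance
  have : Mono ψ.τ₃ := by dsimp [ψ]; infer_instance
  rw [← ShortComplex.exact_iff_of_epi_of_isIso_of_mono ψ,
    ShortComplex.exact_iff_of_epi_of_isIso_of_mono φ]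
  exact h

lemma exact_comp_of_shortExact {X K Y L Z : 𝒜} {p : X ⟶ K} {f : K ⟶ Y} {g : Y ⟶ L} {m : L ⟶ Z}
    {w : f ≫ g = 0} (h : (ShortComplex.mk f g w).ShortExact) [Epi p] [Mono m]
    (w' : (p ≫ f) ≫ g ≫ m = 0) : (ShortComplex.mk (p ≫ f) (g ≫ m) w').Exact := by
  have w₁ : (p ≫ f) ≫ g = 0 := by rw [Category.assoc, w, comp_zero]
  let φ : ShortComplex.mk (p ≫ f) g w₁ ⟶ ShortComplex.mk (p ≫ f) (g ≫ m) w' :=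
    { τ₁ := 𝟙 _, τ₂ := 𝟙 _, τ₃ := m }
  let ψ : ShortComplex.mk (p ≫ f) g w₁ ⟶ ShortComplex.mk f g w :=
    { τ₁ := p, τ₂ := 𝟙 _, τ₃ := 𝟙 _ }
  have : Epi φ.τ₁ := by dsimp [φ]; infer_instance
  have : IsIso φ.τ₂ := by dsimp [φ]; infer_instance
  have : Mono φ.τ₃ := by dsimp [φ]; infer_instance
  have : Epi ψ.τ₁ := by dsimp [ψ]; infer_instance
  have : IsIso ψ.τ₂ := by dsimp [ψ]; infer_instance
  have : Mono ψ.τ₃ := by dsimp [ψ]; infer_instance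
  rw [← ShortComplex.exact_iff_of_epi_of_isIso_of_mono φ,
    ShortComplex.exact_iff_of_epi_of_isIso_of_mono ψ]
  exact h.exact

lemma shortExact_comp_iso {X Y Z Z' : 𝒜} {f : X ⟶ Y} {g : Y ⟶ Z} {w : f ≫ g = 0}
    (h : (ShortComplex.mk f g w).ShortExact) (e : Z ≅ Z') :
    ∃ w' : f ≫ g ≫ e.hom = 0, (ShortComplex.mk f (g ≫ e.hom) w').ShortExact := by
  have w' : f ≫ g ≫ e.hom = 0 := by rw [← Category.assoc, w, zero_comp]
  let i : ShortComplex.mk f g w ≅ ShortComplex.mk f (g ≫ e.hom) w' :=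
    ShortComplex.isoMk (Iso.refl _) (Iso.refl _) e
  exact ⟨w', ShortComplex.shortExact_of_iso i h⟩

lemma shortExact_iso_comp {X X' Y Z : 𝒜} {f : X ⟶ Y} {g : Y ⟶ Z} {w : f ≫ g = 0}
    (h : (ShortComplex.mk f g w).ShortExact) (e : X' ≅ X) :
    ∃ w' : (e.hom ≫ f) ≫ g = 0, (ShortComplex.mk (e.hom ≫ f) g w').ShortExact := by
  have w' : (e.hom ≫ f) ≫ g = 0 := by rw [Category.assoc, w, comp_zero]
  let i : ShortComplex.mk f g w ≅ ShortComplex.mk (e.hom ≫ f) g w' :=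
    ShortComplex.isoMk e.symm (Iso.refl _) (Iso.refl _)
  exact ⟨w', ShortComplex.shortExact_of_iso i h⟩

end ShortExact

section Ext

variable {𝒜 : Type u} [Category.{v} 𝒜] [Abelian 𝒜] [HasExt.{w} 𝒜] {S : ShortComplex 𝒜}

lemma exists_lift_of_ext (hS : S.ShortExact) {X : 𝒜} (h : Subsingleton (Abelian.Ext X S.X₁ 1))
    (f : X ⟶ S.X₃) : ∃ g : X ⟶ S.X₂, g ≫ S.g = f := by
  obtain ⟨y, hy⟩ := Ext.covariant_sequence_exact₃ X hS (Ext.mk₀ f) rfl (Subsingleton.elim _ _)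
  obtain ⟨g, rfl⟩ := (Ext.mk₀_bijective _ _).2 y
  exact ⟨g, (Ext.mk₀_bijective _ _).1 (by simpa using hy)⟩

lemma exists_extension_of_ext (hS : S.ShortExact) {Y : 𝒜}
    (h : Subsingleton (Abelian.Ext S.X₃ Y 1)) (f : S.X₁ ⟶ Y) : ∃ g : S.X₂ ⟶ Y, S.f ≫ g = f := by
  obtain ⟨y, hy⟩ := Ext.contravariant_sequence_exact₁ hS Y (Ext.mk₀ f) rfl (Subsingleton.elim _ _)
  obtain ⟨g, rfl⟩ := (Ext.mk₀_bijective _ _).2 y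
  exact ⟨g, (Ext.mk₀_bijective _ _).1 (by simpa using hy)⟩

lemma subsingleton_ext_to_X₂ (hS : S.ShortExact) {X : 𝒜} {n : ℕ}
    (h₁ : Subsingleton (Abelian.Ext X S.X₁ n)) (h₃ : Subsingleton (Abelian.Ext X S.X₃ n)) :
    Subsingleton (Abelian.Ext X S.X₂ n) := by
  refine subsingleton_of_forall_eq 0 fun x => ?_
  obtain ⟨y, rfl⟩ := Ext.covariant_sequence_exact₂ X hS x (Subsingleton.elim _ _)
  rw [Subsingleton.elim y 0, Ext.zero_comp]

lemma subsingleton_ext_from_X₂ (hS : S.ShortExact) {Y : 𝒜} {n : ℕ}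
    (h₁ : Subsingleton (Abelian.Ext S.X₁ Y n)) (h₃ : Subsingleton (Abelian.Ext S.X₃ Y n)) :
    Subsingleton (Abelian.Ext S.X₂ Y n) := by
  refine subsingleton_of_forall_eq 0 fun x => ?_
  obtain ⟨y, rfl⟩ := Ext.contravariant_sequence_exact₂ hS Y x (Subsingleton.elim _ _)
  rw [Subsingleton.elim y 0, Ext.comp_zero]

lemma subsingleton_ext_to_X₃ (hS : S.ShortExact) {X : 𝒜} {n : ℕ}
    (h₂ : Subsingleton (Abelian.Ext X S.X₂ n)) (h₁ : Subsingleton (Abelian.Ext X S.X₁ (n + 1))) :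
    Subsingleton (Abelian.Ext X S.X₃ n) := by
  refine subsingleton_of_forall_eq 0 fun x => ?_
  obtain ⟨y, rfl⟩ := Ext.covariant_sequence_exact₃ X hS x rfl (Subsingleton.elim _ _)
  rw [Subsingleton.elim y 0, Ext.zero_comp]

lemma subsingleton_ext_from_X₃ (hS : S.ShortExact) {Y : 𝒜} {n : ℕ}
    (h₁ : Subsingleton (Abelian.Ext S.X₁ Y n)) (h₂ : Subsingleton (Abelian.Ext S.X₂ Y (n + 1))) :
    Subsingleton (Abelian.Ext S.X₃ Y (n + 1)) := by
  refine subsingleton_of_forall_eq 0 fun x => ?_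
  obtain ⟨y, rfl⟩ := Ext.contravariant_sequence_exact₃ hS Y x (Subsingleton.elim _ _)
    (add_comm 1 n)
  rw [Subsingleton.elim y 0, Ext.comp_zero]

lemma subsingleton_ext_one_from_X₃ (hS : S.ShortExact) {Y : 𝒜}
    (h₁ : ∀ f : S.X₁ ⟶ Y, ∃ g : S.X₂ ⟶ Y, S.f ≫ g = f)
    (h₂ : Subsingleton (Abelian.Ext S.X₂ Y 1)) : Subsingleton (Abelian.Ext S.X₃ Y 1) := by
  refine subsingleton_of_forall_eq 0 fun x => ?_
  obtain ⟨y, rfl⟩ := Ext.contravariant_sequence_exact₃ hS Y x (Subsingleton.elim _ _) (add_zero 1)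
  obtain ⟨f, rfl⟩ := (Ext.mk₀_bijective _ _).2 y
  obtain ⟨g, rfl⟩ := h₁ f
  rw [← Ext.mk₀_comp_mk₀, ← Ext.comp_assoc_of_second_deg_zero, hS.extClass_comp, Ext.zero_comp]

lemma subsingleton_ext_one_to_X₁ (hS : S.ShortExact) {X : 𝒜}
    (h₃ : ∀ f : X ⟶ S.X₃, ∃ g : X ⟶ S.X₂, g ≫ S.g = f)
    (h₂ : Subsingleton (Abelian.Ext X S.X₂ 1)) : Subsingleton (Abelian.Ext X S.X₁ 1) := by
  refine subsingleton_of_forall_eq 0 fun x => ?_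
  obtain ⟨y, rfl⟩ := Ext.covariant_sequence_exact₁ X hS x (Subsingleton.elim _ _) (zero_add 1)
  obtain ⟨f, rfl⟩ := (Ext.mk₀_bijective _ _).2 y
  obtain ⟨g, rfl⟩ := h₃ f
  rw [← Ext.mk₀_comp_mk₀, Ext.comp_assoc_of_second_deg_zero, hS.comp_extClass, Ext.comp_zero]

end Ext

section Gorenstein

variable {𝒜 : Type u} [Category.{v} 𝒜] [Abelian 𝒜]

lemma IsGorenstein.of_iso {P : 𝒜 → Prop} {X Y : 𝒜} (e : X ≅ Y) (h : IsGorenstein P X) :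
    IsGorenstein P Y := by
  obtain ⟨Z, d, w, h₁, h₂, h₃, h₄, ⟨e'⟩⟩ := h
  exact ⟨Z, d, w, h₁, h₂, h₃, h₄, ⟨e.symm ≪≫ e'⟩⟩

/-- There is a short exact sequence `0 → X → Y → Z → 0` whose middle term is in `P`. -/
def HasStep (P : 𝒜 → Prop) (X Z : 𝒜) : Prop :=
  ∃ (Y : 𝒜) (f : X ⟶ Y) (g : Y ⟶ Z) (w : f ≫ g = 0), P Y ∧ (ShortComplex.mk f g w).ShortExact

/-- The class `Q` is `Ext¹`-orthogonal to `P` on both sides, and each of its objects is both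
a quotient of an object of `P` by an object of `Q`, and a kernel of an epimorphism from an object
of `P` to an object of `Q`. -/
structure IsGorensteinClass [HasExt.{w} 𝒜] (P Q : 𝒜 → Prop) : Prop where
  ext_left : ∀ X, Q X → ∀ C, P C → Subsingleton (Abelian.Ext X C 1)
  ext_right : ∀ X, Q X → ∀ C, P C → Subsingleton (Abelian.Ext C X 1)
  gen : ∀ X, Q X → ∃ K, Q K ∧ HasStep P K X
  cogen : ∀ X, Q X → ∃ L, Q L ∧ HasStep P X L

lemma Res.mono {P Q : 𝒜 → Prop} (hPQ : ∀ X, P X → Q X) {n : ℕ} {K A : 𝒜} (h : Res P n K A) :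
    Res Q n K A := by
  induction n generalizing A with
  | zero => exact h
  | succ n ih =>
    obtain ⟨B, Y, f, g, w, hY, hs, -, h⟩ := h
    exact ⟨B, Y, f, g, w, hPQ Y hY, hs, trivial, ih h⟩

variable [HasExt.{w} 𝒜]

/-- A complex of objects of `Q` indexed by `ℤ`, taking the value `A` at `1`, whose consecutive
terms are linked by short exact sequences with middle term in `P`. -/
lemma IsGorensteinClass.exists_chain {P Q : 𝒜 → Prop} (h : IsGorensteinClass P Q) {A : 𝒜}
    (hA : Q A) :
    ∃ Z : ℤ → 𝒜, (∀ i, Q (Z i)) ∧ (∀ i, HasStep P (Z i) (Z (i + 1))) ∧ Z 1 = A := by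
  have hl (X : {X // Q X}) : ∃ K : {X // Q X}, HasStep P K.1 X.1 := by
    obtain ⟨K, hK, hs⟩ := h.gen X.1 X.2
    exact ⟨⟨K, hK⟩, hs⟩
  have hr (X : {X // Q X}) : ∃ K : {X // Q X}, HasStep P X.1 K.1 := by
    obtain ⟨K, hK, hs⟩ := h.cogen X.1 X.2
    exact ⟨⟨K, hK⟩, hs⟩
  choose l hl using hl
  choose r hr using hr
  let Z : ℤ → {X // Q X} := fun i => match i with
    | Int.ofNat 0 => l ⟨A, hA⟩
    | Int.ofNat (n + 1) => r^[n] ⟨A, hA⟩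
    | Int.negSucc n => l^[n + 2] ⟨A, hA⟩
  refine ⟨fun i => (Z i).1, fun i => (Z i).2, fun i => ?_, rfl⟩
  match i with
  | Int.ofNat 0 => exact hl ⟨A, hA⟩
  | Int.ofNat (n + 1) =>
    change HasStep P (r^[n] ⟨A, hA⟩).1 (r^[n + 1] ⟨A, hA⟩).1
    rw [Function.iterate_succ_apply']
    exact hr _
  | Int.negSucc 0 => exact hl (l ⟨A, hA⟩)
  | Int.negSucc (n + 1) =>
    change HasStep P (l^[n + 3] ⟨A, hA⟩).1 (l^[n + 2] ⟨A, hA⟩).1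
    rw [Function.iterate_succ_apply' l (n + 2)]
    exact hl _

lemma IsGorensteinClass.isGorenstein {P Q : 𝒜 → Prop} (h : IsGorensteinClass P Q) {A : 𝒜}
    (hA : Q A) : IsGorenstein P A := by
  obtain ⟨Z, hZ, hs, rfl⟩ := h.exists_chain hA
  choose X f g w hX hse using hs
  have _ (i) : Mono (f i) := (hse i).mono_f
  have _ (i) : Epi (g i) := (hse i).epi_g
  refine ⟨X, fun i => g i ≫ f (i + 1), fun i => ?_, hX, fun i => ?_, ?_, ?_, ?_⟩
  · simp only [Category.assoc]
    rw [← Category.assoc (f (i + 1)), w, zero_comp, comp_zero]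
  · exact exact_comp_of_shortExact (hse (i + 1)) _
  · intro C hC i a ha
    have ha' : a ≫ g (i + 1) = 0 := by
      rw [← cancel_mono (f (i + 1 + 1))]
      simpa using ha
    obtain ⟨b, hb⟩ : ∃ b, b ≫ f (i + 1) = a :=
      ⟨(hse (i + 1)).fIsKernel.lift (KernelFork.ofι a ha'),
        (hse (i + 1)).fIsKernel.fac _ WalkingParallelPair.zero⟩
    obtain ⟨c, hc⟩ := exists_lift_of_ext (hse i) (h.ext_right _ (hZ _) C hC) b
    exact ⟨c, by simpa [hb] using congrArg (· ≫ f (i + 1)) hc⟩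
  · intro C hC i a ha
    have ha' : f (i + 1) ≫ a = 0 := by
      rw [← cancel_epi (g i)]
      simpa using ha
    obtain ⟨b, hb⟩ : ∃ b, g (i + 1) ≫ b = a :=
      ⟨(hse (i + 1)).gIsCokernel.desc (CokernelCofork.ofπ a ha'),
        (hse (i + 1)).gIsCokernel.fac _ WalkingParallelPair.one⟩
    obtain ⟨c, hc⟩ := exists_extension_of_ext (hse (i + 1 + 1)) (h.ext_left _ (hZ _) C hC) b
    exact ⟨c, by simpa [hb] using congrArg (g (i + 1) ≫ ·) hc⟩
  · have := strongEpi_of_epi (g 0)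
    exact ⟨Limits.image.isoStrongEpiMono (I' := Z (0 + 1)) (g 0) (f (0 + 1)) rfl⟩

lemma IsGorenstein.exists_isGorensteinClass {P : 𝒜 → Prop}
    (horth : ∀ C₁ C₂ : 𝒜, P C₁ → P C₂ → ∀ i : ℕ, 1 ≤ i → Subsingleton (Abelian.Ext C₁ C₂ i))
    {A : 𝒜} (hA : IsGorenstein P A) : ∃ Q : 𝒜 → Prop, IsGorensteinClass P Q ∧ Q A := by
  obtain ⟨X, d, w, hX, hexact, hcov, hcontra, hA⟩ := hA
  have hse (i) := shortExact_image (hexact i)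
  choose hw hse using hse
  have hprev (i : ℤ) : ∃ j, i = j + 1 := ⟨i - 1, by lia⟩
  refine ⟨fun Y => ∃ i, Nonempty (Y ≅ Limits.image (d i)), ⟨?_, ?_, ?_, ?_⟩, 0, hA⟩
  · rintro Y ⟨i, ⟨e⟩⟩ C hC
    obtain ⟨j, rfl⟩ := hprev i
    obtain ⟨k, rfl⟩ := hprev j
    obtain ⟨w', h⟩ := shortExact_comp_iso (hse (k + 1)) e.symm
    refine subsingleton_ext_one_from_X₃ h (fun f => ?_) (horth _ _ (hX _) hC 1 le_rfl)
    obtain ⟨g, hg⟩ := hcontra C hC k (factorThruImage (d (k + 1)) ≫ f) (by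
      have : d k ≫ factorThruImage (d (k + 1)) = 0 := by
        rw [← cancel_mono (Limits.image.ι (d (k + 1)))]
        simpa using w k
      rw [← Category.assoc, this, zero_comp])
    refine ⟨g, ?_⟩
    rw [← cancel_epi (factorThruImage (d (k + 1)))]
    simpa using hg
  · rintro Y ⟨i, ⟨e⟩⟩ C hC
    obtain ⟨w', h⟩ := shortExact_iso_comp (hse i) e
    refine subsingleton_ext_one_to_X₁ h (fun f => ?_) (horth _ _ hC (hX _) 1 le_rfl)
    obtain ⟨g, hg⟩ := hcov C hC (i + 1) (f ≫ Limits.image.ι (d (i + 1))) (by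
      have : Limits.image.ι (d (i + 1)) ≫ d (i + 1 + 1) = 0 := by
        rw [← cancel_epi (factorThruImage (d (i + 1)))]
        simpa using w (i + 1)
      rw [Category.assoc, this, comp_zero])
    refine ⟨g, ?_⟩
    rw [← cancel_mono (Limits.image.ι (d (i + 1)))]
    simpa using hg
  · rintro Y ⟨i, ⟨e⟩⟩
    obtain ⟨j, rfl⟩ := hprev i
    obtain ⟨w', h⟩ := shortExact_comp_iso (hse j) e.symm
    exact ⟨_, ⟨j, ⟨Iso.refl _⟩⟩, _, _, _, w', hX _, h⟩
  · rintro Y ⟨i, ⟨e⟩⟩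
    obtain ⟨w', h⟩ := shortExact_iso_comp (hse i) e
    exact ⟨_, ⟨i + 1, ⟨Iso.refl _⟩⟩, _, _, _, w', hX _, h⟩

lemma isGorensteinClass_isGorenstein {P : 𝒜 → Prop}
    (horth : ∀ C₁ C₂ : 𝒜, P C₁ → P C₂ → ∀ i : ℕ, 1 ≤ i → Subsingleton (Abelian.Ext C₁ C₂ i)) :
    IsGorensteinClass P (IsGorenstein P) := by
  refine ⟨fun X hX C hC => ?_, fun X hX C hC => ?_, fun X hX => ?_, fun X hX => ?_⟩ <;>
    obtain ⟨Q, hQ, hXQ⟩ := hX.exists_isGorensteinClass horth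
  · exact hQ.ext_left X hXQ C hC
  · exact hQ.ext_right X hXQ C hC
  · obtain ⟨K, hK, hs⟩ := hQ.gen X hXQ
    exact ⟨K, hQ.isGorenstein hK, hs⟩
  · obtain ⟨L, hL, hs⟩ := hQ.cogen X hXQ
    exact ⟨L, hQ.isGorenstein hL, hs⟩

lemma IsGorenstein.subsingleton_ext {P : 𝒜 → Prop}
    (horth : ∀ C₁ C₂ : 𝒜, P C₁ → P C₂ → ∀ i : ℕ, 1 ≤ i → Subsingleton (Abelian.Ext C₁ C₂ i))
    {X : 𝒜} (hX : IsGorenstein P X) {C : 𝒜} (hC : P C) (n : ℕ) :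
    Subsingleton (Abelian.Ext X C (n + 1)) := by
  induction n generalizing X with
  | zero => exact (isGorensteinClass_isGorenstein horth).ext_left X hX C hC
  | succ n ih =>
    obtain ⟨K, hK, Y, f, g, w, hY, h⟩ := (isGorensteinClass_isGorenstein horth).gen X hX
    exact subsingleton_ext_from_X₃ h (ih hK) (horth Y C hY hC _ (by lia))

lemma isGorenstein_of_mem {P : 𝒜 → Prop} (h₀ : P 0)
    (horth : ∀ C₁ C₂ : 𝒜, P C₁ → P C₂ → ∀ i : ℕ, 1 ≤ i → Subsingleton (Abelian.Ext C₁ C₂ i))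
    {C : 𝒜} (hC : P C) : IsGorenstein P C := by
  have h : IsGorensteinClass P P :=
    { ext_left := fun X hX C hC => horth X C hX hC 1 le_rfl
      ext_right := fun X hX C hC => horth C X hC hX 1 le_rfl
      gen := fun X hX => ⟨0, h₀, X, 0, 𝟙 X, zero_comp, hX,
        (ShortComplex.Splitting.ofIsZeroOfIsIso _ (isZero_zero _)
          (inferInstanceAs (IsIso (𝟙 X)))).shortExact⟩
      cogen := fun X hX => ⟨0, h₀, X, 𝟙 X, 0, comp_zero, hX,
        (ShortComplex.Splitting.ofIsIsoOfIsZero _ (inferInstanceAs (IsIso (𝟙 X)))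
          (isZero_zero _)).shortExact⟩ }
  exact h.isGorenstein hC

lemma IsGorenstein.of_shortExact {P : 𝒜 → Prop} (hadd : ∀ ⦃X Y : 𝒜⦄, P X → P Y → P (X ⊞ Y))
    (horth : ∀ C₁ C₂ : 𝒜, P C₁ → P C₂ → ∀ i : ℕ, 1 ≤ i → Subsingleton (Abelian.Ext C₁ C₂ i))
    {S : ShortComplex 𝒜} (hS : S.ShortExact) (h₁ : IsGorenstein P S.X₁)
    (h₃ : IsGorenstein P S.X₃) : IsGorenstein P S.X₂ := by
  have hG := isGorensteinClass_isGorenstein horth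
  let Q : 𝒜 → Prop := fun X => ∃ S : ShortComplex 𝒜,
    S.ShortExact ∧ IsGorenstein P S.X₁ ∧ IsGorenstein P S.X₃ ∧ S.X₂ = X
  have hQ : IsGorensteinClass P Q := by
    refine ⟨?_, ?_, ?_, ?_⟩
    · rintro _ ⟨S, hS, h₁, h₃, rfl⟩ C hC
      exact subsingleton_ext_from_X₂ hS (hG.ext_left _ h₁ C hC) (hG.ext_left _ h₃ C hC)
    · rintro _ ⟨S, hS, h₁, h₃, rfl⟩ C hC
      exact subsingleton_ext_to_X₂ hS (hG.ext_right _ h₁ C hC) (hG.ext_right _ h₃ C hC)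
    · rintro _ ⟨S, hS, h₁, h₃, rfl⟩
      obtain ⟨K₁, hK₁, C₁, f₁, g₁, w₁, hC₁, hs₁⟩ := hG.gen _ h₁
      obtain ⟨K₃, hK₃, C₃, f₃, g₃, w₃, hC₃, hs₃⟩ := hG.gen _ h₃
      obtain ⟨l, hl⟩ := exists_lift_of_ext hS (hG.ext_right _ h₁ C₃ hC₃) g₃
      let φ : ShortComplex.mk (biprod.inl : C₁ ⟶ C₁ ⊞ C₃) biprod.snd biprod.inl_snd ⟶ S :=
        { τ₁ := g₁
          τ₂ := biprod.desc (g₁ ≫ S.f) l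
          τ₃ := g₃ }
      obtain ⟨R, ψ, u₁, u₂, u₃, hR, t₁, t₂, t₃⟩ :=
        exists_shortExact_kernel (shortExact_biprod C₁ C₃) hS φ hs₁.epi_g hs₃.epi_g
      obtain ⟨e₁⟩ := nonempty_iso_of_shortExact_g hs₁ t₁
      obtain ⟨e₃⟩ := nonempty_iso_of_shortExact_g hs₃ t₃
      exact ⟨R.X₂, ⟨R, hR, hK₁.of_iso e₁, hK₃.of_iso e₃, rfl⟩, _, _, _, u₂, hadd hC₁ hC₃, t₂⟩
    · rintro _ ⟨S, hS, h₁, h₃, rfl⟩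
      obtain ⟨K₁, hK₁, C₁, f₁, g₁, w₁, hC₁, hs₁⟩ := hG.cogen _ h₁
      obtain ⟨K₃, hK₃, C₃, f₃, g₃, w₃, hC₃, hs₃⟩ := hG.cogen _ h₃
      obtain ⟨l, hl⟩ := exists_extension_of_ext hS (hG.ext_left _ h₃ C₁ hC₁) f₁
      let φ : S ⟶ ShortComplex.mk (biprod.inl : C₁ ⟶ C₁ ⊞ C₃) biprod.snd biprod.inl_snd :=
        { τ₁ := f₁
          τ₂ := biprod.lift l (S.g ≫ f₃)
          τ₃ := f₃
          comm₁₂ := by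
            apply biprod.hom_ext
            · simp [hl]
            · simp }
      obtain ⟨R, ψ, u₁, u₂, u₃, hR, t₁, t₂, t₃⟩ :=
        exists_shortExact_cokernel hS (shortExact_biprod C₁ C₃) φ hs₁.mono_f hs₃.mono_f
      obtain ⟨e₁⟩ := nonempty_iso_of_shortExact_f hs₁ t₁
      obtain ⟨e₃⟩ := nonempty_iso_of_shortExact_f hs₃ t₃
      exact ⟨R.X₂, ⟨R, hR, hK₁.of_iso e₁, hK₃.of_iso e₃, rfl⟩, _, _, _, u₂, hadd hC₁ hC₃, t₂⟩
  exact hQ.isGorenstein ⟨S, hS, h₁, h₃, rfl⟩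

/-- A Gorenstein object that is right `Ext¹`-orthogonal to all Gorenstein objects is in `P`. -/
lemma IsGorenstein.mem_of_ext {P : 𝒜 → Prop} (hiso : ∀ ⦃X Y : 𝒜⦄, (X ≅ Y) → P X → P Y)
    (horth : ∀ C₁ C₂ : 𝒜, P C₁ → P C₂ → ∀ i : ℕ, 1 ≤ i → Subsingleton (Abelian.Ext C₁ C₂ i))
    (hsum : ClosedUnderSummands P) {X : 𝒜} (hX : IsGorenstein P X)
    (h : ∀ G, IsGorenstein P G → Subsingleton (Abelian.Ext G X 1)) : P X := by
  obtain ⟨L, hL, C, f, g, w, hC, hs⟩ := (isGorensteinClass_isGorenstein horth).cogen X hX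
  obtain ⟨r, hr⟩ := exists_extension_of_ext hs (h L hL) (𝟙 X)
  let σ := ShortComplex.Splitting.ofExactOfRetraction _ hs.exact r hr hs.epi_g
  exact (hsum X L (hiso σ.isoBinaryBiproduct hC)).1

lemma Res.subsingleton_ext {P : 𝒜 → Prop}
    (horth : ∀ C₁ C₂ : 𝒜, P C₁ → P C₂ → ∀ i : ℕ, 1 ≤ i → Subsingleton (Abelian.Ext C₁ C₂ i))
    (hiso : ∀ ⦃X Y : 𝒜⦄, (X ≅ Y) → P X → P Y) {X : 𝒜} (hX : IsGorenstein P X) {K A : 𝒜}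
    (hK : P K) {n : ℕ} (h : Res P n K A) (i : ℕ) : Subsingleton (Abelian.Ext X A (i + 1)) := by
  induction n generalizing A i with
  | zero =>
    obtain ⟨e⟩ := h
    exact hX.subsingleton_ext horth (hiso e hK) i
  | succ n ih =>
    obtain ⟨B, Y, f, g, w, hY, hs, -, h⟩ := h
    exact subsingleton_ext_to_X₃ hs (hX.subsingleton_ext horth hY i) (ih h (i + 1))

/-- From `0 → H → Y → A → 0` with `Y` Gorenstein and `H` of finite `P`-dimension `n`, one gets
`0 → A → H' → L → 0` with `L` Gorenstein and `H'` of `P`-dimension at most `n + 1`. -/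
lemma exists_hull_of_precover {P : 𝒜 → Prop}
    (horth : ∀ C₁ C₂ : 𝒜, P C₁ → P C₂ → ∀ i : ℕ, 1 ≤ i → Subsingleton (Abelian.Ext C₁ C₂ i))
    {H Y A K : 𝒜} {j : H ⟶ Y} {q : Y ⟶ A} {w : j ≫ q = 0}
    (hs : (ShortComplex.mk j q w).ShortExact) (hY : IsGorenstein P Y) {n : ℕ} (hH : Res P n K H) :
    ∃ (H' L : 𝒜) (f : A ⟶ H') (g : H' ⟶ L) (w : f ≫ g = 0), IsGorenstein P L ∧
      Res P (n + 1) K H' ∧ (ShortComplex.mk f g w).ShortExact := by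
  obtain ⟨L, hL, C, f, g, w', hC, ht⟩ := (isGorensteinClass_isGorenstein horth).cogen Y hY
  have : Mono f := ht.mono_f
  have sq := IsPushout.of_hasPushout f q
  obtain ⟨g', w₁, h₁⟩ := exists_shortExact_of_isPushout ht sq
  obtain ⟨w₂, h₂⟩ := shortExact_of_isPushout hs sq
  exact ⟨_, L, _, g', w₁, hL, ⟨H, C, _, _, w₂, hC, h₂, trivial, hH⟩, h₁⟩

/-- From `0 → B → Y → A → 0` with `Y` Gorenstein and `0 → B → H → L → 0` with `L` Gorenstein, one
gets `0 → H → Y' → A → 0` with `Y'` Gorenstein. -/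
lemma exists_precover_of_hull {P : 𝒜 → Prop} (hadd : ∀ ⦃X Y : 𝒜⦄, P X → P Y → P (X ⊞ Y))
    (horth : ∀ C₁ C₂ : 𝒜, P C₁ → P C₂ → ∀ i : ℕ, 1 ≤ i → Subsingleton (Abelian.Ext C₁ C₂ i))
    {B Y A H L : 𝒜} {f : B ⟶ Y} {g : Y ⟶ A} {w : f ≫ g = 0}
    (hs : (ShortComplex.mk f g w).ShortExact) (hY : IsGorenstein P Y) {k : B ⟶ H} {p : H ⟶ L}
    {w' : k ≫ p = 0} (ht : (ShortComplex.mk k p w').ShortExact) (hL : IsGorenstein P L) :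
    ∃ (Y' : 𝒜) (j : H ⟶ Y') (q : Y' ⟶ A) (w : j ≫ q = 0), IsGorenstein P Y' ∧
      (ShortComplex.mk j q w).ShortExact := by
  have sq := IsPushout.of_hasPushout f k
  obtain ⟨q, w₁, h₁⟩ := exists_shortExact_of_isPushout hs sq
  obtain ⟨p', w₂, h₂⟩ := exists_shortExact_of_isPushout ht sq.flip
  exact ⟨_, _, q, w₁, IsGorenstein.of_shortExact hadd horth h₂ hY hL, h₁⟩

lemma exists_hull {P : 𝒜 → Prop} (hadd : ∀ ⦃X Y : 𝒜⦄, P X → P Y → P (X ⊞ Y))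
    (horth : ∀ C₁ C₂ : 𝒜, P C₁ → P C₂ → ∀ i : ℕ, 1 ≤ i → Subsingleton (Abelian.Ext C₁ C₂ i))
    {K A : 𝒜} (hK : IsGorenstein P K) {n : ℕ} (h : Res (IsGorenstein P) n K A) :
    ∃ (K' H L : 𝒜) (f : A ⟶ H) (g : H ⟶ L) (w : f ≫ g = 0), P K' ∧ IsGorenstein P L ∧
      Res P n K' H ∧ (ShortComplex.mk f g w).ShortExact := by
  induction n generalizing A with
  | zero =>
    obtain ⟨e⟩ := h
    obtain ⟨L, hL, C, f, g, w, hC, hs⟩ :=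
      (isGorensteinClass_isGorenstein horth).cogen A (hK.of_iso e)
    exact ⟨C, C, L, f, g, w, hC, hL, ⟨Iso.refl C⟩, hs⟩
  | succ n ih =>
    obtain ⟨B, Y, f, g, w, hY, hs, -, h⟩ := h
    obtain ⟨K', H, L, k, p, w', hK', hL, hH, ht⟩ := ih h
    obtain ⟨Y', j, q, w₁, hY', h₁⟩ := exists_precover_of_hull hadd horth hs hY ht hL
    obtain ⟨H', L', f', g', w₂, hL', hH', h₂⟩ := exists_hull_of_precover horth h₁ hY' hH
    exact ⟨K', H', L', f', g', w₂, hK', hL', hH', h₂⟩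

/-- An object of `𝒢(P)^⊥` with a resolution of length `n` by Gorenstein objects has a resolution
of length `n` by objects of `P`. -/
lemma exists_res_of_memRightPerp {P : 𝒜 → Prop} (hP : IsAdditiveClass P)
    (horth : ∀ C₁ C₂ : 𝒜, P C₁ → P C₂ → ∀ i : ℕ, 1 ≤ i → Subsingleton (Abelian.Ext C₁ C₂ i))
    (hsum : ClosedUnderSummands P) {A : 𝒜} (hA : MemRightPerp (IsGorenstein P) A) {K : 𝒜}
    (hK : IsGorenstein P K) {n : ℕ} (h : Res (IsGorenstein P) n K A) :
    ∃ K', P K' ∧ Res P n K' A := by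
  obtain ⟨-, hiso, hadd⟩ := hP
  cases n with
  | zero =>
    obtain ⟨e⟩ := h
    exact ⟨A, (hK.of_iso e).mem_of_ext hiso horth hsum (fun G hG => hA G hG 1 le_rfl),
      ⟨Iso.refl A⟩⟩
  | succ n =>
    obtain ⟨B, Y, f, g, w, hY, hs, -, h⟩ := h
    obtain ⟨K', H, L, k, p, w', hK', hL, hH, ht⟩ := exists_hull hadd horth hK h
    obtain ⟨Y', j, q, w₁, hY', h₁⟩ := exists_precover_of_hull hadd horth hs hY ht hL
    have hY'' : P Y' := hY'.mem_of_ext hiso horth hsum fun G hG =>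
      subsingleton_ext_to_X₂ h₁ (Res.subsingleton_ext horth hiso hG hK' hH 0) (hA G hG 1 le_rfl)
    exact ⟨K', hK', H, Y', j, q, w₁, hY'', h₁, trivial, hH⟩

end Gorenstein

end RelHomDim

open RelHomDim in
/-- Corollary 3.12. -/
theorem stmt14 {𝒜 : Type u} [Category.{v} 𝒜] [Abelian 𝒜] [HasExt.{w} 𝒜]
    (𝒞 : 𝒜 → Prop) (h𝒞 : IsAdditiveClass 𝒞)
    (horth : ∀ C₁ C₂ : 𝒜, 𝒞 C₁ → 𝒞 C₂ → ∀ i : ℕ, 1 ≤ i →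
      Subsingleton (Abelian.Ext C₁ C₂ i))
    (hsum : ClosedUnderSummands 𝒞)
    (A : 𝒜) (hA : MemRightPerp (IsGorenstein 𝒞) A) :
    rdim (IsGorenstein 𝒞) A = rdim 𝒞 A := by
  refine le_antisymm (sInf_le_sInf ?_) (sInf_le_sInf ?_)
  · rintro _ ⟨n, rfl, K, hK, h⟩
    have hC : ∀ X, 𝒞 X → IsGorenstein 𝒞 X := fun X => isGorenstein_of_mem h𝒞.1 horth
    exact ⟨n, rfl, K, hC K hK, h.mono hC⟩
  · rintro _ ⟨n, rfl, K, hK, h⟩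
    exact ⟨n, rfl, exists_res_of_memRightPerp h𝒞 horth hsum hA hK h⟩
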